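/- arXiv:1401.3181 — 2 statements merged into one kernel-verified Lean document; each statement's English description precedes it below -/
import Mathlib

section
/- Define the 4×4 matrices with ±1 entries: Σ_1 with rows (−1,−1,+1,+1), (+1,+1,+1,+1), (+1,+1,+1,+1), (+1,+1,+1,+1); Σ_2 with rows (−1,−1,+1,+1), (+1,−1,−1,+1), (+1,+1,+1,+1), (+1,+1,+1,+1); Σ_3 with rows (−1,−1,+1,+1), (+1,−1,+1,+1), (+1,+1,−1,+1), (+1,+1,+1,+1); and the transposes Σ_1ᵀ, Σ_2ᵀ. Then each of the five matrices Σ_1, Σ_1ᵀ, Σ_2, Σ_2ᵀ, Σ_3 has permanent 0, they are pairwise inequivalent, and every 4×4 matrix with entries ±1 whose permanent is 0 is equivalent to one of these five matrices. -/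
noncomputable section

open scoped BigOperators

/-- The permanent of an `n × n` matrix. -/
def perm {n : ℕ} (M : Matrix (Fin n) (Fin n) ℤ) : ℤ :=
  ∑ l : Equiv.Perm (Fin n), ∏ i, M i (l i)

/-- Two `n × n` matrices with entries `±1` are equivalent if one is obtained from the other
by permuting rows and columns and negating rows and columns: `B i j = ε i * δ j * A (π i) (τ j)`
for permutations `π, τ` and signs `ε, δ`. -/
def MatEquiv {n : ℕ} (A B : Matrix (Fin n) (Fin n) ℤ) : Prop :=
  ∃ (π τ : Equiv.Perm (Fin n)) (ε δ : Fin n → ℤ),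
    (∀ i, ε i = 1 ∨ ε i = -1) ∧ (∀ j, δ j = 1 ∨ δ j = -1) ∧
      ∀ i j, B i j = ε i * δ j * A (π i) (τ j)

def Sigma1 : Matrix (Fin 4) (Fin 4) ℤ :=
  !![-1, -1, 1, 1; 1, 1, 1, 1; 1, 1, 1, 1; 1, 1, 1, 1]

def Sigma2 : Matrix (Fin 4) (Fin 4) ℤ :=
  !![-1, -1, 1, 1; 1, -1, -1, 1; 1, 1, 1, 1; 1, 1, 1, 1]

def Sigma3 : Matrix (Fin 4) (Fin 4) ℤ :=
  !![-1, -1, 1, 1; 1, -1, 1, 1; 1, 1, -1, 1; 1, 1, 1, 1]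

namespace MatEquiv

variable {n : ℕ} {A B C : Matrix (Fin n) (Fin n) ℤ}

theorem trans (hAB : MatEquiv A B) (hBC : MatEquiv B C) : MatEquiv A C := by
  obtain ⟨π, τ, ε, δ, hε, hδ, h⟩ := hAB
  obtain ⟨π', τ', ε', δ', hε', hδ', h'⟩ := hBC
  refine ⟨π'.trans π, τ'.trans τ, fun i ↦ ε' i * ε (π' i), fun j ↦ δ' j * δ (τ' j), ?_, ?_, ?_⟩
  · intro i
    rcases hε' i with h1 | h1 <;> rcases hε (π' i) with h2 | h2 <;> simp [h1, h2]
  · intro j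
    rcases hδ' j with h1 | h1 <;> rcases hδ (τ' j) with h2 | h2 <;> simp [h1, h2]
  · intro i j
    rw [h', h]
    simp only [Equiv.trans_apply]
    ring

theorem transpose (h : MatEquiv A B) : MatEquiv A.transpose B.transpose := by
  obtain ⟨π, τ, ε, δ, hε, hδ, h⟩ := h
  refine ⟨τ, π, δ, ε, hδ, hε, fun i j ↦ ?_⟩
  rw [Matrix.transpose_apply, Matrix.transpose_apply, h, mul_comm (δ i)]

theorem perm_eq_zero (h : MatEquiv A B) (hA : perm A = 0) : perm B = 0 := by
  obtain ⟨π, τ, ε, δ, -, -, h⟩ := h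
  have key : perm B = (∏ i, ε i) * (∏ j, δ j) * perm A := by
    unfold perm
    rw [Finset.mul_sum]
    refine Fintype.sum_equiv ((Equiv.mulLeft τ).trans (Equiv.mulRight π⁻¹)) _ _ fun l ↦ ?_
    simp only [h, Finset.prod_mul_distrib]
    rw [Equiv.prod_comp l δ, ← Equiv.prod_comp π fun i ↦ A i _]
    simp
  rw [key, hA, mul_zero]

end MatEquiv

/-- The sum of the fourth powers of the inner products of pairs of rows. -/
def rowGramQuartic {n : ℕ} (A : Matrix (Fin n) (Fin n) ℤ) : ℤ :=
  ∑ i, ∑ k, (∑ j, A i j * A k j) ^ 4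

theorem MatEquiv.rowGramQuartic_eq {n : ℕ} {A B : Matrix (Fin n) (Fin n) ℤ}
    (h : MatEquiv A B) : rowGramQuartic B = rowGramQuartic A := by
  obtain ⟨π, τ, ε, δ, hε, hδ, h⟩ := h
  have inner (i k : Fin n) :
      (∑ j, B i j * B k j) ^ 4 = (∑ j, A (π i) j * A (π k) j) ^ 4 := by
    have hsum : ∑ j, B i j * B k j = ε i * ε k * ∑ j, A (π i) j * A (π k) j := by
      rw [← Equiv.sum_comp τ fun j ↦ A (π i) j * A (π k) j, Finset.mul_sum]
      refine Finset.sum_congr rfl fun j _ ↦ ?_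
      have hj : δ j * δ j = 1 := by rcases hδ j with h1 | h1 <;> simp [h1]
      rw [h, h]
      linear_combination (ε i * ε k * A (π i) (τ j) * A (π k) (τ j)) * hj
    rw [hsum, mul_pow]
    rcases hε i with h1 | h1 <;> rcases hε k with h2 | h2 <;> simp [h1, h2]
  simp only [rowGramQuartic, inner]
  rw [Equiv.sum_comp π fun i ↦ ∑ k, (∑ j, A i j * A (π k) j) ^ 4]
  exact Finset.sum_congr rfl fun i _ ↦
    Equiv.sum_comp π fun k ↦ (∑ j, A i j * A k j) ^ 4

/-- The sign `-1` or `1` encoded by a Boolean. -/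
def boolSign (b : Bool) : ℤ := bif b then -1 else 1

theorem boolSign_eq (b : Bool) : boolSign b = 1 ∨ boolSign b = -1 := by
  cases b <;> simp [boolSign]

theorem boolSign_xor (a b : Bool) : boolSign (a ^^ b) = boolSign a * boolSign b := by
  cases a <;> cases b <;> rfl

/-- The sign matrix with an entry `-1` at `(i, j)` exactly when bit `j` of `c i` is set. -/
def codeMatrix (c : Fin 4 → ℕ) : Matrix (Fin 4) (Fin 4) ℤ :=
  fun i j ↦ boolSign ((c i).testBit j)

/-- Every sign matrix is equivalent to one whose first row and last column are `1` and whose rows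
are sorted by their codes. -/
theorem exists_matEquiv_codeMatrix (M : Matrix (Fin 4) (Fin 4) ℤ)
    (hM : ∀ i j, M i j = 1 ∨ M i j = -1) :
    ∃ c : Fin 4 → ℕ, (∀ i, c i < 8) ∧ Monotone c ∧ c 0 = 0 ∧ MatEquiv M (codeMatrix c) := by
  have hsq (i j : Fin 4) : M i j * M i j = 1 := by rcases hM i j with h | h <;> simp [h]
  have hmul {x y : ℤ} (hx : x = 1 ∨ x = -1) (hy : y = 1 ∨ y = -1) : x * y = 1 ∨ x * y = -1 := by
    rcases hx with h | h <;> rcases hy with h' | h' <;> simp [h, h']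
  let N : Matrix (Fin 4) (Fin 4) ℤ := fun i j ↦ M i 3 * (M 0 j * M 0 3) * M i j
  have hN (i j) : N i j = 1 ∨ N i j = -1 :=
    hmul (hmul (hM _ _) (hmul (hM _ _) (hM _ _))) (hM _ _)
  have hN0 (j) : N 0 j = 1 := by
    linear_combination (M 0 3 * M 0 3) * hsq 0 j + hsq 0 3
  have hN3 (i) : N i 3 = 1 := by
    linear_combination (M i 3 * M i 3) * hsq 0 3 + hsq i 3
  have hMN : MatEquiv M N :=
    ⟨1, 1, fun i ↦ M i 3, fun j ↦ M 0 j * M 0 3, fun i ↦ hM _ _,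
      fun j ↦ hmul (hM _ _) (hM _ _), fun _ _ ↦ rfl⟩
  have hrow (i : Fin 4) : ∃ k < 8, ∀ j : Fin 4, boolSign (k.testBit j) = N i j := by
    have hall : ∀ a b c : Bool, ∃ k < 8, ∀ j : Fin 4, k.testBit j = ![a, b, c, false] j := by
      decide
    obtain ⟨k, hk, hbit⟩ := hall (N i 0 = -1) (N i 1 = -1) (N i 2 = -1)
    refine ⟨k, hk, fun j ↦ ?_⟩
    rw [hbit]
    fin_cases j
    · rcases hN i 0 with h | h <;> simp [boolSign, h]
    · rcases hN i 1 with h | h <;> simp [boolSign, h]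
    · rcases hN i 2 with h | h <;> simp [boolSign, h]
    · simp [boolSign, hN3]
  choose d hd hdN using hrow
  have hd0 : d 0 = 0 := by
    have hzero : ∀ k < 8, (∀ j : Fin 4, boolSign (k.testBit j) = 1) → k = 0 := by decide
    exact hzero _ (hd 0) fun j ↦ by rw [hdN, hN0]
  have hmono : Monotone (d ∘ Tuple.sort d) := Tuple.monotone_sort d
  refine ⟨d ∘ Tuple.sort d, fun i ↦ hd _, hmono, ?_, hMN.trans
    ⟨Tuple.sort d, 1, fun _ ↦ 1, fun _ ↦ 1, by simp, by simp, fun i j ↦ ?_⟩⟩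
  · have h := hmono (Fin.zero_le ((Tuple.sort d).symm 0))
    simp only [Function.comp_apply, Equiv.apply_symm_apply, hd0] at h
    simpa using h
  · simp [codeMatrix, hdN]

/-- The row codes of `Σ₁, Σ₁ᵀ, Σ₂, Σ₂ᵀ, Σ₃`. -/
def representativeCodes : List (Fin 4 → ℕ) :=
  [![3, 0, 0, 0], ![1, 1, 0, 0], ![3, 6, 0, 0], ![1, 3, 2, 0], ![3, 2, 4, 0]]

theorem map_codeMatrix_representativeCodes :
    representativeCodes.map codeMatrix =
      [Sigma1, Sigma1.transpose, Sigma2, Sigma2.transpose, Sigma3] := by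
  simp only [representativeCodes, List.map_cons, List.map_nil, List.cons.injEq, and_true]
  refine ⟨?_, ?_, ?_, ?_, ?_⟩ <;> ext i j <;> fin_cases i <;> fin_cases j <;> rfl

/-- The permutations of `Fin 4`, listed by their values so that they evaluate quickly. -/
def permVectors : List (Fin 4 → Fin 4) :=
  [![0, 1, 2, 3], ![0, 1, 3, 2], ![0, 2, 1, 3], ![0, 2, 3, 1], ![0, 3, 1, 2], ![0, 3, 2, 1],
   ![1, 0, 2, 3], ![1, 0, 3, 2], ![1, 2, 0, 3], ![1, 2, 3, 0], ![1, 3, 0, 2], ![1, 3, 2, 0],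
   ![2, 0, 1, 3], ![2, 0, 3, 1], ![2, 1, 0, 3], ![2, 1, 3, 0], ![2, 3, 0, 1], ![2, 3, 1, 0],
   ![3, 0, 1, 2], ![3, 0, 2, 1], ![3, 1, 0, 2], ![3, 1, 2, 0], ![3, 2, 0, 1], ![3, 2, 1, 0]]

theorem injective_of_mem_permVectors : ∀ p ∈ permVectors, Function.Injective p := by
  decide +kernel

/-- Normalising the last row and column to `1`, after rearranging rows by `p` and columns by `q`,
turns the matrix with row codes `c` into the one with row codes `d`. The test is Boolean-valued
because this is much cheaper for the kernel than a `Decidable` proposition. -/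
def normalizesTo (c d : Fin 4 → ℕ) (p q : Fin 4 → Fin 4) : Bool :=
  [0, 1, 2, 3].all fun i ↦ [0, 1, 2, 3].all fun j : Fin 4 ↦ (d i).testBit j ==
    ((c (p i)).testBit (q 3) ^^ ((c (p 3)).testBit (q j) ^^ (c (p 3)).testBit (q 3)) ^^
      (c (p i)).testBit (q j))

theorem matEquiv_of_normalizesTo {c d : Fin 4 → ℕ} {p q : Fin 4 → Fin 4}
    (hp : p.Injective) (hq : q.Injective) (h : normalizesTo c d p q = true) :
    MatEquiv (codeMatrix c) (codeMatrix d) := by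
  have hmem : ∀ i : Fin 4, i ∈ [0, 1, 2, 3] := by decide
  simp only [normalizesTo, List.all_eq_true, beq_iff_eq] at h
  refine ⟨Equiv.ofBijective p (Finite.injective_iff_bijective.mp hp),
    Equiv.ofBijective q (Finite.injective_iff_bijective.mp hq),
    fun i ↦ boolSign ((c (p i)).testBit (q 3)),
    fun j ↦ boolSign ((c (p 3)).testBit (q j) ^^ (c (p 3)).testBit (q 3)),
    fun _ ↦ boolSign_eq _, fun _ ↦ boolSign_eq _, fun i j ↦ ?_⟩
  simp only [codeMatrix, h i (hmem i) j (hmem j), boolSign_xor, Equiv.ofBijective_apply]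

theorem exists_normalizesTo_of_perm_eq_zero :
    ∀ z < 8, ∀ y ≤ z, ∀ x ≤ y, perm (codeMatrix ![0, x, y, z]) = 0 →
      (permVectors.any fun q ↦ permVectors.any fun p ↦ representativeCodes.any fun d ↦
        normalizesTo ![0, x, y, z] d p q) = true := by
  decide +kernel

/-- Classification of `4 × 4` `(±1)`-matrices with vanishing permanents: the five matrices
`Σ₁, Σ₁ᵀ, Σ₂, Σ₂ᵀ, Σ₃` all have vanishing permanent, they are pairwise inequivalent, and every
`4 × 4` `(±1)`-matrix with vanishing permanent is equivalent to one of them. -/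
theorem classification_four_by_four :
    (∀ A ∈ [Sigma1, Sigma1.transpose, Sigma2, Sigma2.transpose, Sigma3], perm A = 0) ∧
    (∀ A ∈ [Sigma1, Sigma1.transpose, Sigma2, Sigma2.transpose, Sigma3],
      ∀ B ∈ [Sigma1, Sigma1.transpose, Sigma2, Sigma2.transpose, Sigma3],
        A ≠ B → ¬ MatEquiv A B) ∧
    (∀ M : Matrix (Fin 4) (Fin 4) ℤ, (∀ i j, M i j = 1 ∨ M i j = -1) → perm M = 0 →
      ∃ A ∈ [Sigma1, Sigma1.transpose, Sigma2, Sigma2.transpose, Sigma3], MatEquiv M A) := by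
  refine ⟨by decide +kernel, ?_, fun M hM hperm ↦ ?_⟩
  · intro A hA B hB hne h
    have separated : ∀ A ∈ [Sigma1, Sigma1.transpose, Sigma2, Sigma2.transpose, Sigma3],
        ∀ B ∈ [Sigma1, Sigma1.transpose, Sigma2, Sigma2.transpose, Sigma3],
        rowGramQuartic B = rowGramQuartic A →
        rowGramQuartic B.transpose = rowGramQuartic A.transpose → A = B := by
      decide +kernel
    exact hne (separated A hA B hB h.rowGramQuartic_eq h.transpose.rowGramQuartic_eq)
  · obtain ⟨c, hc, hmono, hc0, hMc⟩ := exists_matEquiv_codeMatrix M hM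
    have hceq : c = ![0, c 1, c 2, c 3] := by
      ext i
      fin_cases i <;> simp [hc0]
    have hzero := hMc.perm_eq_zero hperm
    rw [hceq] at hzero
    have hsearch := exists_normalizesTo_of_perm_eq_zero (c 3) (hc 3) (c 2)
      (hmono (by decide)) (c 1) (hmono (by decide)) hzero
    simp only [List.any_eq_true] at hsearch
    obtain ⟨q, hq, p, hp, d, hd, h⟩ := hsearch
    rw [← hceq] at h
    refine ⟨codeMatrix d, ?_, hMc.trans
      (matEquiv_of_normalizesTo (injective_of_mem_permVectors p hp)
        (injective_of_mem_permVectors q hq) h)⟩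
    rw [← map_codeMatrix_representativeCodes]
    exact List.mem_map_of_mem hd
end
end

section
/- Let ρ be a Hermitian positive semidefinite matrix indexed by (Fin 2)³ (a three-qubit state, up to normalization) such that ρ^{T(S)} is positive semidefinite for every subset S ⊆ {1,2,3} (ρ is PPT). Suppose there exists no nonzero product vector ψ = ψ_1 ⊗ ψ_2 ⊗ ψ_3 (all ψ_j ∈ ℂ² nonzero) such that ψ^{Γ(S)} lies in the range (column space) of ρ^{T(S)} for every subset S ⊆ {1,2,3} (ρ is an edge state). Then rank ρ + rank ρ^{T({1})} + rank ρ^{T({2})} + rank ρ^{T({3})} ≤ 28. -/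
noncomputable section

open scoped BigOperators ComplexOrder

/-- The partial transpose `ρ^{T(S)}` of a three-qubit matrix `ρ`, transposing the qubits
in `S`. -/
def partialTranspose (ρ : Matrix (Fin 3 → Fin 2) (Fin 3 → Fin 2) ℂ) (S : Finset (Fin 3)) :
    Matrix (Fin 3 → Fin 2) (Fin 3 → Fin 2) ℂ :=
  Matrix.of fun x y =>
    ρ (fun m => if m ∈ S then y m else x m) (fun m => if m ∈ S then x m else y m)

/-- The product vector `ψ₁ ⊗ ψ₂ ⊗ ψ₃` in `ℂ² ⊗ ℂ² ⊗ ℂ²`, realized as the space of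
complex-valued functions on `(Fin 2)³`. -/
def prodVec (ψ : Fin 3 → Fin 2 → ℂ) : (Fin 3 → Fin 2) → ℂ :=
  fun x => ∏ j, ψ j (x j)

/-- The partial conjugate `ψ^{Γ(S)}` of the product vector `ψ₁ ⊗ ψ₂ ⊗ ψ₃`. -/
def partialConj (S : Finset (Fin 3)) (ψ : Fin 3 → Fin 2 → ℂ) : (Fin 3 → Fin 2) → ℂ :=
  prodVec fun j => if j ∈ S then fun i => starRingEnd ℂ (ψ j i) else ψ j

/-- Identity or complex conjugation on `ℂ`, according to a Boolean flag. -/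
def conjIf (b : Bool) : ℂ →+* ℂ := if b then starRingEnd ℂ else RingHom.id ℂ

@[simp] lemma conjIf_true (z : ℂ) : conjIf true z = starRingEnd ℂ z := rfl

@[simp] lemma conjIf_false (z : ℂ) : conjIf false z = z := rfl

@[fun_prop] lemma continuous_conjIf (b : Bool) : Continuous (conjIf b) := by
  cases b
  · exact continuous_id
  · exact Complex.continuous_conj

lemma conjIf_conjIf (a b : Bool) (z : ℂ) : conjIf a (conjIf b z) = conjIf (a ^^ b) z := by
  cases a <;> cases b <;> simp

lemma conjIf_eq_zpow (b : Bool) {z : ℂ} (hz : ‖z‖ = 1) :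
    conjIf b z = z ^ (if b then -1 else 1 : ℤ) := by
  cases b
  · simp
  · simp [Complex.inv_eq_conj hz]

/-- A continuous function on `ℂ²` that is equivariant of nonzero weight under the circle has a
zero off the origin. -/
lemma exists_zero_of_circle_equivariant (f : ℂ × ℂ → ℂ) (hf : Continuous f) (n : ℤ) (hn : n ≠ 0)
    (h : ∀ z : ℂ, ‖z‖ = 1 → ∀ p, f (z * p.1, z * p.2) = z ^ n * f p) :
    ∃ p, p ≠ 0 ∧ f p = 0 := by
  by_contra! hne
  let g : ℂ → ℂ := fun t => f (t, ((Real.sqrt (1 - ‖t‖ ^ 2) : ℝ) : ℂ))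
  have hg : Continuous g := by fun_prop
  have hg0 : ∀ t, g t ≠ 0 := by
    intro t
    apply hne
    intro h0
    have h1 : t = 0 := congrArg Prod.fst h0
    have h2 := congrArg Prod.snd h0
    simp [h1] at h2
  obtain ⟨L, ⟨-, hexp⟩, -⟩ := Complex.isCoveringMapOn_exp.existsUnique_continuousMap_lifts
    ⟨g, hg⟩ (Complex.exp_log (hg0 0)) hg0
  have hL : Continuous L := L.continuous
  have hcirc : ∀ θ : ℝ, Complex.exp (L (Complex.exp (θ * Complex.I)) - n * (θ * Complex.I))
      = f (1, 0) := by
    intro θ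
    have h1 := congrFun hexp (Complex.exp (θ * Complex.I))
    have hnorm := Complex.norm_exp_ofReal_mul_I θ
    have h2 := h _ hnorm (1, 0)
    simp only [Function.comp_apply, ContinuousMap.coe_mk, g, hnorm] at h1
    simp only [mul_one, mul_zero] at h2
    rw [Complex.exp_sub, h1, Complex.exp_int_mul]
    simp only [one_pow, sub_self, Real.sqrt_zero, Complex.ofReal_zero, h2]
    exact mul_div_cancel_left₀ _ (zpow_ne_zero _ (Complex.exp_ne_zero _))
  let k : ℝ → ℂ := fun θ => L (Complex.exp (θ * Complex.I)) - n * (θ * Complex.I)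
  have hk : Continuous k := by fun_prop
  have hconst : ∀ θ, k θ = k 0 := by
    refine fun θ => Complex.isCoveringMap_exp.const_of_comp hk (fun a a' => Subtype.ext ?_) θ 0
    exact (hcirc a).trans (hcirc a').symm
  have := hconst (2 * Real.pi)
  simp [k, hn] at this

/-- The norm for `b = true`, the identity for `b = false`. It sends `s ^ 2` to `conjIf b s * s`. -/
def normIf (b : Bool) (w : ℂ) : ℂ := if b then (‖w‖ : ℂ) else w

@[fun_prop] lemma continuous_normIf (b : Bool) : Continuous (normIf b) := by
  cases b
  · exact continuous_id
  · exact Complex.continuous_ofReal.comp continuous_norm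

lemma normIf_sq_mul (b : Bool) (s w : ℂ) : normIf b (s ^ 2 * w) = conjIf b s * s * normIf b w := by
  cases b
  · simp [normIf, sq]
  · simp [normIf, Complex.conj_mul']

lemma normIf_sq (b : Bool) (s : ℂ) : normIf b (s ^ 2) = conjIf b s * s := by
  simpa [normIf] using normIf_sq_mul b s 1

/-- The bilinear form on `ℂ² × ℂ²` with coefficients `F`. -/
def bil (F : Fin 2 → Fin 2 → ℂ) (y z : Fin 2 → ℂ) : ℂ := ∑ i, ∑ j, F i j * y i * z j

lemma bil_eq (F : Fin 2 → Fin 2 → ℂ) (y z : Fin 2 → ℂ) :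
    bil F y z = F 0 0 * y 0 * z 0 + F 0 1 * y 0 * z 1 + F 1 0 * y 1 * z 0 + F 1 1 * y 1 * z 1 := by
  simp [bil, Fin.sum_univ_two]; ring

/-- The determinant of the form `F`. -/
def formDet (F : Fin 2 → Fin 2 → ℂ) : ℂ := F 0 0 * F 1 1 - F 0 1 * F 1 0

/-- The polarization of `formDet`. -/
def formPolar (F G : Fin 2 → Fin 2 → ℂ) : ℂ :=
  F 0 0 * G 1 1 + G 0 0 * F 1 1 - F 0 1 * G 1 0 - G 0 1 * F 1 0

/-- The discriminant of `formDet` on the pencil spanned by `F` and `G`. -/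
def pencilDisc (F G : Fin 2 → Fin 2 → ℂ) : ℂ :=
  formPolar F G ^ 2 - 4 * formDet F * formDet G

/-- The symmetric matrix `F J Gᵀ - G J Fᵀ`. -/
def pencilLeft (F G : Fin 2 → Fin 2 → ℂ) (i k : Fin 2) : ℂ :=
  F i 0 * G k 1 - F i 1 * G k 0 - (G i 0 * F k 1 - G i 1 * F k 0)

/-- The symmetric matrix `Fᵀ J G - Gᵀ J F`. -/
def pencilRight (F G : Fin 2 → Fin 2 → ℂ) (j l : Fin 2) : ℂ :=
  F 0 j * G 1 l - F 1 j * G 0 l - (G 0 j * F 1 l - G 1 j * F 0 l)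

/-- The matrix `Jᵀ M J`. -/
def formAdj (M : Fin 2 → Fin 2 → ℂ) : Fin 2 → Fin 2 → ℂ :=
  ![![M 1 1, -M 1 0], ![-M 0 1, M 0 0]]

/-- Up to a nonzero factor, the product of the values of `M (conjIf b y) z` over the two common
zeros `(y, z)` of the bilinear forms `F` and `G`. -/
def pencilResultant (b : Bool) (F G M : Fin 2 → Fin 2 → ℂ) : ℂ :=
  (∑ i, ∑ k, ∑ j, ∑ l, conjIf b (pencilLeft F G i k) * formAdj M i j * formAdj M k l *
    pencilRight F G j l) - 2 * formDet M * normIf b (pencilDisc F G)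

lemma pencilResultant_comb (b : Bool) (F G M : Fin 2 → Fin 2 → ℂ) (s t u v w : ℂ) :
    pencilResultant b (s • F + t • G) (u • F + v • G) (w • M) =
      conjIf b (s * v - t * u) * (s * v - t * u) * w ^ 2 * pencilResultant b F G M := by
  have h1 : pencilDisc (s • F + t • G) (u • F + v • G) = (s * v - t * u) ^ 2 * pencilDisc F G := by
    simp [pencilDisc, formPolar, formDet]; ring
  have h2 : ∀ i k, pencilLeft (s • F + t • G) (u • F + v • G) i k =
      (s * v - t * u) * pencilLeft F G i k := by
    intro i k; simp [pencilLeft]; ring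
  have h3 : ∀ i k, pencilRight (s • F + t • G) (u • F + v • G) i k =
      (s * v - t * u) * pencilRight F G i k := by
    intro i k; simp [pencilRight]; ring
  have h4 : ∀ i k, formAdj (w • M) i k = w * formAdj M i k := by
    intro i k; fin_cases i <;> fin_cases k <;> simp [formAdj]
  have h5 : formDet (w • M) = w ^ 2 * formDet M := by simp [formDet]; ring
  simp only [pencilResultant, h1, h2, h3, h4, h5, normIf_sq_mul, map_mul, Fin.sum_univ_two]
  ring

lemma pencilResultant_rankOne (b : Bool) (M : Fin 2 → Fin 2 → ℂ) (p q r s : Fin 2 → ℂ) :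
    pencilResultant b (fun i j => p i * q j) (fun i j => r i * s j) M =
      4 * conjIf b (q 0 * s 1 - q 1 * s 0) * (p 0 * r 1 - p 1 * r 0) *
        bil M (fun i => conjIf b (![p 1, -p 0] i)) ![s 1, -s 0] *
        bil M (fun i => conjIf b (![r 1, -r 0] i)) ![q 1, -q 0] := by
  have h1 : pencilDisc (fun i j => p i * q j) (fun i j => r i * s j) =
      ((p 0 * r 1 - p 1 * r 0) * (q 0 * s 1 - q 1 * s 0)) ^ 2 := by
    simp [pencilDisc, formPolar, formDet]; ring
  simp [pencilResultant, h1, normIf_sq, Fin.sum_univ_two, bil_eq, formAdj, pencilLeft,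
    pencilRight, formDet]
  ring

lemma exists_rankOne {F : Fin 2 → Fin 2 → ℂ} (h : formDet F = 0) :
    ∃ p q : Fin 2 → ℂ, F = fun i j => p i * q j := by
  unfold formDet at h
  by_cases h0 : F 0 = 0
  · refine ⟨![0, 1], F 1, ?_⟩
    ext i j; fin_cases i <;> simp [h0]
  · obtain ⟨j, hj⟩ := Function.ne_iff.mp h0
    simp only [Pi.zero_apply] at hj
    refine ⟨![1, F 1 j / F 0 j], F 0, ?_⟩
    ext i k
    fin_cases i
    · simp
    · simp only [Fin.mk_one, Matrix.cons_val_one, Matrix.cons_val_zero]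
      field_simp
      fin_cases j <;> fin_cases k <;> simp at hj ⊢ <;>
        first | linear_combination h | linear_combination -h

lemma perp_ne_zero {p : Fin 2 → ℂ} (hp : p ≠ 0) : ![p 1, -p 0] ≠ 0 := by
  contrapose! hp
  have h0 := congrFun hp 0
  have h1 := congrFun hp 1
  ext i; fin_cases i <;> simp_all

lemma exists_smul_of_wedge_eq_zero {p r : Fin 2 → ℂ} (hp : p ≠ 0)
    (h : p 0 * r 1 - p 1 * r 0 = 0) : ∃ c : ℂ, r = c • p := by
  obtain ⟨j, hj⟩ := Function.ne_iff.mp hp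
  simp only [Pi.zero_apply] at hj
  refine ⟨r j / p j, ?_⟩
  ext k
  simp only [Pi.smul_apply, smul_eq_mul]
  field_simp
  fin_cases j <;> fin_cases k <;> simp at hj ⊢ <;>
    first | linear_combination h | linear_combination -h

/-- A linear form on `ℂ²` has a nonzero zero. -/
lemma exists_ne_zero_linear (u v : ℂ) : ∃ y : Fin 2 → ℂ, y ≠ 0 ∧ u * y 0 + v * y 1 = 0 := by
  by_cases h : (![u, v] : Fin 2 → ℂ) = 0
  · have h0 := congrFun h 0
    have h1 := congrFun h 1
    exact ⟨![1, 0], by simp, by simp_all⟩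
  · exact ⟨![v, -u], perp_ne_zero h, by simp; ring⟩

lemma exists_left_zero (M : Fin 2 → Fin 2 → ℂ) (b : Bool) (z : Fin 2 → ℂ) :
    ∃ y : Fin 2 → ℂ, y ≠ 0 ∧ bil M (fun i => conjIf b (y i)) z = 0 := by
  obtain ⟨y, hy, h⟩ := exists_ne_zero_linear (M 0 0 * z 0 + M 0 1 * z 1) (M 1 0 * z 0 + M 1 1 * z 1)
  refine ⟨fun i => conjIf b (y i), ?_, ?_⟩
  · contrapose! hy
    ext i
    simpa using congrFun hy i
  · simp only [conjIf_conjIf, Bool.xor_self, conjIf_false, bil_eq]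
    linear_combination h

lemma exists_right_zero (M : Fin 2 → Fin 2 → ℂ) (y : Fin 2 → ℂ) :
    ∃ z : Fin 2 → ℂ, z ≠ 0 ∧ bil M y z = 0 := by
  obtain ⟨z, hz, h⟩ := exists_ne_zero_linear (M 0 0 * y 0 + M 1 0 * y 1) (M 0 1 * y 0 + M 1 1 * y 1)
  exact ⟨z, hz, by rw [bil_eq]; linear_combination h⟩

/-- `F`, `G` and `M` have a common zero, with a possible conjugation in the last equation. -/
def HasCommonZero (b : Bool) (F G M : Fin 2 → Fin 2 → ℂ) : Prop :=
  ∃ y z : Fin 2 → ℂ, y ≠ 0 ∧ z ≠ 0 ∧ bil F y z = 0 ∧ bil G y z = 0 ∧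
    bil M (fun i => conjIf b (y i)) z = 0

lemma HasCommonZero.of_comb {b : Bool} {F G M : Fin 2 → Fin 2 → ℂ} {s t u v : ℂ}
    (hd : s * v - t * u ≠ 0) (h : HasCommonZero b (s • F + t • G) (u • F + v • G) M) :
    HasCommonZero b F G M := by
  obtain ⟨y, z, hy, hz, h1, h2, h3⟩ := h
  simp only [bil_eq, Pi.add_apply, Pi.smul_apply, smul_eq_mul] at h1 h2
  refine ⟨y, z, hy, hz, ?_, ?_, h3⟩
  · apply (mul_eq_zero.mp _).resolve_left hd
    rw [bil_eq]; linear_combination v * h1 - t * h2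
  · apply (mul_eq_zero.mp _).resolve_left hd
    rw [bil_eq]; linear_combination s * h2 - u * h1

lemma hasCommonZero_of_isotropic {b : Bool} {F G M : Fin 2 → Fin 2 → ℂ} (hF : F ≠ 0)
    (hG : G ≠ 0) (hFd : formDet F = 0) (hGd : formDet G = 0)
    (h : pencilResultant b F G M = 0) : HasCommonZero b F G M := by
  obtain ⟨p, q, rfl⟩ := exists_rankOne hFd
  obtain ⟨r, s, rfl⟩ := exists_rankOne hGd
  have hp : p ≠ 0 := by rintro rfl; exact hF (by ext; simp)
  have hq : q ≠ 0 := by rintro rfl; exact hF (by ext; simp)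
  have hr : r ≠ 0 := by rintro rfl; exact hG (by ext; simp)
  have hs : s ≠ 0 := by rintro rfl; exact hG (by ext; simp)
  rw [pencilResultant_rankOne] at h
  simp only [mul_eq_zero, OfNat.ofNat_ne_zero, false_or, map_eq_zero] at h
  rcases h with ((h | h) | h) | h
  · obtain ⟨c, rfl⟩ := exists_smul_of_wedge_eq_zero hq h
    obtain ⟨y, hy, h⟩ := exists_left_zero M b ![q 1, -q 0]
    refine ⟨y, _, hy, perp_ne_zero hq, ?_, ?_, h⟩ <;> simp [bil_eq] <;> ring
  · obtain ⟨c, rfl⟩ := exists_smul_of_wedge_eq_zero hp h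
    obtain ⟨z, hz, h⟩ := exists_right_zero M (fun i => conjIf b (![p 1, -p 0] i))
    refine ⟨_, z, perp_ne_zero hp, hz, ?_, ?_, h⟩ <;> simp [bil_eq] <;> ring
  · refine ⟨_, _, perp_ne_zero hp, perp_ne_zero hs, ?_, ?_, h⟩ <;> simp [bil_eq] <;> ring
  · refine ⟨_, _, perp_ne_zero hr, perp_ne_zero hq, ?_, ?_, h⟩ <;> simp [bil_eq] <;> ring

lemma hasCommonZero_of_tangent {b : Bool} {F G M : Fin 2 → Fin 2 → ℂ} (hF : F ≠ 0)
    (hFd : formDet F = 0) (hFG : formPolar F G = 0) (hGd : formDet G ≠ 0)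
    (h : pencilResultant b F G M = 0) : HasCommonZero b F G M := by
  obtain ⟨p, q, rfl⟩ := exists_rankOne hFd
  have hp : p ≠ 0 := by rintro rfl; exact hF (by ext; simp)
  have hq : q ≠ 0 := by rintro rfl; exact hF (by ext; simp)
  refine ⟨_, _, perp_ne_zero hp, perp_ne_zero hq, ?_, ?_, ?_⟩
  · simp [bil_eq]; ring
  · simp only [formPolar] at hFG
    simp [bil_eq]; linear_combination hFG
  obtain ⟨c, hc⟩ : ∃ c : ℂ, ![G 0 0 * q 1 - G 0 1 * q 0, G 1 0 * q 1 - G 1 1 * q 0] = c • p :=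
    exists_smul_of_wedge_eq_zero hp (by simp [formPolar] at hFG ⊢; linear_combination -hFG)
  obtain ⟨d, hd⟩ : ∃ d : ℂ, ![G 0 0 * p 1 - G 1 0 * p 0, G 0 1 * p 1 - G 1 1 * p 0] = d • q :=
    exists_smul_of_wedge_eq_zero hq (by simp [formPolar] at hFG ⊢; linear_combination -hFG)
  have hc0 : c ≠ 0 := by
    rintro rfl
    have h0 := congrFun hc 0
    have h1 := congrFun hc 1
    simp at h0 h1
    apply hq
    have e0 : formDet G * q 0 = 0 := by unfold formDet; linear_combination G 1 0 * h0 - G 0 0 * h1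
    have e1 : formDet G * q 1 = 0 := by unfold formDet; linear_combination G 1 1 * h0 - G 0 1 * h1
    ext i; fin_cases i <;> simp_all
  have hd0 : d ≠ 0 := by
    rintro rfl
    have h0 := congrFun hd 0
    have h1 := congrFun hd 1
    simp at h0 h1
    apply hp
    have e0 : formDet G * p 0 = 0 := by unfold formDet; linear_combination G 0 1 * h0 - G 0 0 * h1
    have e1 : formDet G * p 1 = 0 := by unfold formDet; linear_combination G 1 1 * h0 - G 1 0 * h1
    ext i; fin_cases i <;> simp_all
  have hc' : ∀ i, G i 0 * q 1 - G i 1 * q 0 = c * p i := by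
    intro i; have := congrFun hc i; fin_cases i <;> simpa using this
  have hd' : ∀ j, G 0 j * p 1 - G 1 j * p 0 = d * q j := by
    intro i; have := congrFun hd i; fin_cases i <;> simpa using this
  have hL : ∀ i k, pencilLeft (fun i j => p i * q j) G i k = -2 * c * p i * p k := by
    intro i k
    simp only [pencilLeft]
    linear_combination -p i * hc' k - p k * hc' i
  have hR : ∀ i k, pencilRight (fun i j => p i * q j) G i k = -2 * d * q i * q k := by
    intro i k
    simp only [pencilRight]
    linear_combination -q i * hd' k - q k * hd' i
  have hdisc : pencilDisc (fun i j => p i * q j) G = 0 := by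
    rw [pencilDisc, hFG, hFd]; ring
  have key : 4 * conjIf b c * d * bil M (fun i => conjIf b (![p 1, -p 0] i)) ![q 1, -q 0] ^ 2 = 0 := by
    have h2 : conjIf b 2 = 2 := map_ofNat _ 2
    rw [← h]
    simp [h2, pencilResultant, hL, hR, hdisc, normIf, Fin.sum_univ_two, bil_eq, formAdj]
    ring
  simpa [hc0, hd0] using key

lemma hasCommonZero_of_formDet_eq_zero {b : Bool} {F G M : Fin 2 → Fin 2 → ℂ}
    (hli : ∀ s t : ℂ, s • F + t • G = 0 → s = 0 ∧ t = 0) (hFd : formDet F = 0)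
    (h : pencilResultant b F G M = 0) : HasCommonZero b F G M := by
  have hF : F ≠ 0 := fun h0 => by simpa using hli 1 0 (by simp [h0])
  have hG : G ≠ 0 := fun h0 => by simpa using hli 0 1 (by simp [h0])
  by_cases hFG : formPolar F G = 0
  · by_cases hGd : formDet G = 0
    · exact hasCommonZero_of_isotropic hF hG hFd hGd h
    · exact hasCommonZero_of_tangent hF hFd hFG hGd h
  · set u := -formDet G / formPolar F G
    apply HasCommonZero.of_comb (s := 1) (t := 0) (u := u) (v := 1) (by simp)
    apply hasCommonZero_of_isotropic
    · simpa using hF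
    · intro h0; simpa using hli u 1 h0
    · simpa using hFd
    · have : formDet (u • F + (1 : ℂ) • G) = u ^ 2 * formDet F + u * formPolar F G + formDet G := by
        simp [formDet, formPolar]; ring
      rw [this, hFd]
      simp only [u]; field_simp; ring
    · have := pencilResultant_comb b F G M 1 0 u 1 1
      rw [one_smul ℂ M] at this
      rw [this, h, mul_zero]

/-- If the resultant of `M` with respect to a genuine pencil `F, G` vanishes, then the three forms
have a common zero. -/
lemma hasCommonZero_of_pencilResultant_eq_zero {b : Bool} {F G M : Fin 2 → Fin 2 → ℂ}
    (hli : ∀ s t : ℂ, s • F + t • G = 0 → s = 0 ∧ t = 0)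
    (h : pencilResultant b F G M = 0) : HasCommonZero b F G M := by
  by_cases hFd : formDet F = 0
  · exact hasCommonZero_of_formDet_eq_zero hli hFd h
  obtain ⟨e, he⟩ := IsAlgClosed.exists_pow_nat_eq (pencilDisc F G) (n := 2) (by norm_num)
  set s := (-formPolar F G + e) / (2 * formDet F) with hs
  apply HasCommonZero.of_comb (s := s) (t := 1) (u := 1) (v := 0) (by simp)
  apply hasCommonZero_of_formDet_eq_zero
  · intro c d hcd
    obtain ⟨h1, rfl⟩ := hli (c * s + d) c (by rw [← hcd]; ext; simp; ring)
    exact ⟨rfl, by simpa using h1⟩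
  · have : formDet (s • F + (1 : ℂ) • G) = s ^ 2 * formDet F + s * formPolar F G + formDet G := by
      simp [formDet, formPolar]; ring
    rw [this, hs]
    unfold pencilDisc at he
    field_simp
    linear_combination he
  · have := pencilResultant_comb b F G M s 1 1 0 1
    rw [one_smul ℂ M] at this
    rw [this, h, mul_zero]

/-- Entrywise `conjIf`. -/
def conjVec (b : Bool) (x : Fin 2 → ℂ) : Fin 2 → ℂ := fun i => conjIf b (x i)

lemma conjVec_conjVec (a b : Bool) (x : Fin 2 → ℂ) :
    conjVec a (conjVec b x) = conjVec (a ^^ b) x := funext fun _ => conjIf_conjIf _ _ _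

lemma conjVec_ne_zero (b : Bool) {x : Fin 2 → ℂ} (hx : x ≠ 0) : conjVec b x ≠ 0 := by
  contrapose! hx
  ext i
  simpa [conjVec] using congrFun hx i

@[fun_prop] lemma continuous_conjVec (b : Bool) : Continuous (conjVec b) := by
  unfold conjVec; fun_prop

/-- The bilinear form obtained from a trilinear form by fixing the first argument. -/
def slice (t : Fin 2 → Fin 2 → Fin 2 → ℂ) (x : Fin 2 → ℂ) : Fin 2 → Fin 2 → ℂ :=
  fun j k => ∑ i, x i * t i j k

/-- The trilinear form with coefficients `t`. -/
def tri (t : Fin 2 → Fin 2 → Fin 2 → ℂ) (x y z : Fin 2 → ℂ) : ℂ :=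
  ∑ i, ∑ j, ∑ k, t i j k * (x i * y j * z k)

lemma bil_slice (t : Fin 2 → Fin 2 → Fin 2 → ℂ) (x y z : Fin 2 → ℂ) :
    bil (slice t x) y z = tri t x y z := by
  simp [bil_eq, slice, tri, Fin.sum_univ_two]; ring

lemma slice_smul (t : Fin 2 → Fin 2 → Fin 2 → ℂ) (c : ℂ) (x : Fin 2 → ℂ) :
    slice t (c • x) = c • slice t x := by
  ext; simp [slice, Fin.sum_univ_two]; ring

lemma tri_smul (t : Fin 2 → Fin 2 → Fin 2 → ℂ) (a b c : ℂ) (x y z : Fin 2 → ℂ) :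
    tri t (a • x) (b • y) (c • z) = a * b * c * tri t x y z := by
  simp [tri, Fin.sum_univ_two]; ring

lemma conjVec_smul (b : Bool) (c : ℂ) (x : Fin 2 → ℂ) :
    conjVec b (c • x) = conjIf b c • conjVec b x := by
  ext; simp [conjVec]

lemma conjIf_tri (b : Bool) (t : Fin 2 → Fin 2 → Fin 2 → ℂ) (x y z : Fin 2 → ℂ) :
    conjIf b (tri t x y z) =
      tri (fun i j k => conjIf b (t i j k)) (conjVec b x) (conjVec b y) (conjVec b z) := by
  simp [tri, conjVec]

lemma Continuous.tri {X : Type*} [TopologicalSpace X] {t : X → Fin 2 → Fin 2 → Fin 2 → ℂ}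
    {x y z : X → Fin 2 → ℂ} (ht : Continuous t) (hx : Continuous x) (hy : Continuous y)
    (hz : Continuous z) : Continuous fun p => tri (t p) (x p) (y p) (z p) := by
  unfold _root_.tri; fun_prop

lemma Continuous.slice {X : Type*} [TopologicalSpace X] (t : Fin 2 → Fin 2 → Fin 2 → ℂ)
    {x : X → Fin 2 → ℂ} (hx : Continuous x) : Continuous fun p => slice t (x p) := by
  unfold _root_.slice; fun_prop

lemma Continuous.pencilResultant {X : Type*} [TopologicalSpace X] (b : Bool)
    {F G M : X → Fin 2 → Fin 2 → ℂ} (hF : Continuous F) (hG : Continuous G) (hM : Continuous M) :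
    Continuous fun p => pencilResultant b (F p) (G p) (M p) := by
  simp only [_root_.pencilResultant, pencilLeft, pencilRight, pencilDisc, formPolar, formDet,
    formAdj, Fin.sum_univ_two, Matrix.cons_val_zero, Matrix.cons_val_one]
  fun_prop

lemma exists_common_zero_of_generic (a₁ a₂ a₃ b : Bool) (t₁ t₂ t₃ : Fin 2 → Fin 2 → Fin 2 → ℂ)
    (hli : ∀ x y, slice t₁ x + slice t₂ y = 0 → x = 0 ∧ y = 0) :
    ∃ x y z : Fin 2 → ℂ, x ≠ 0 ∧ y ≠ 0 ∧ z ≠ 0 ∧ tri t₁ (conjVec a₁ x) y z = 0 ∧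
      tri t₂ (conjVec a₂ x) y z = 0 ∧ tri t₃ (conjVec a₃ x) (conjVec b y) z = 0 := by
  let g : Bool → ℤ := fun a => if a then -1 else 1
  have hc : ∀ (a : Bool) (t : Fin 2 → Fin 2 → Fin 2 → ℂ),
      Continuous fun p : ℂ × ℂ => slice t (conjVec a ![p.1, p.2]) :=
    fun a t => Continuous.slice t (by fun_prop)
  obtain ⟨p, hp, h⟩ := exists_zero_of_circle_equivariant
    (fun p => pencilResultant b (slice t₁ (conjVec a₁ ![p.1, p.2]))
      (slice t₂ (conjVec a₂ ![p.1, p.2])) (slice t₃ (conjVec a₃ ![p.1, p.2])))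
    ((hc a₁ t₁).pencilResultant b (hc a₂ t₂) (hc a₃ t₃))
    ((g a₁ + g a₂) * g b + (g a₁ + g a₂) + g a₃ * 2)
    (by cases a₁ <;> cases a₂ <;> cases a₃ <;> cases b <;> decide) (by
      intro z hz p
      have hz0 : z ≠ 0 := by rintro rfl; simp at hz
      have hv : (![z * p.1, z * p.2] : Fin 2 → ℂ) = z • ![p.1, p.2] := by simp
      have hw : ‖z ^ g a₁ * z ^ g a₂‖ = 1 := by simp [hz]
      have := pencilResultant_comb b (slice t₁ (conjVec a₁ ![p.1, p.2]))
        (slice t₂ (conjVec a₂ ![p.1, p.2])) (slice t₃ (conjVec a₃ ![p.1, p.2]))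
        (conjIf a₁ z) 0 0 (conjIf a₂ z) (conjIf a₃ z)
      simp only [zero_smul, add_zero, zero_add, mul_zero, sub_zero] at this
      simp only [hv, conjVec_smul, slice_smul, this]
      congr 1
      rw [conjIf_eq_zpow a₁ hz, conjIf_eq_zpow a₂ hz, conjIf_eq_zpow a₃ hz, conjIf_eq_zpow b hw,
        zpow_add₀ hz0, zpow_add₀ hz0, zpow_mul, zpow_mul, zpow_add₀ hz0]
      rfl)
  have hx : (![p.1, p.2] : Fin 2 → ℂ) ≠ 0 := by
    contrapose! hp
    exact Prod.ext (congrFun hp 0) (congrFun hp 1)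
  obtain ⟨y, z, hy, hz, h1, h2, h3⟩ := hasCommonZero_of_pencilResultant_eq_zero (by
    intro s t hst
    rw [← slice_smul, ← slice_smul] at hst
    obtain ⟨h1, h2⟩ := hli _ _ hst
    exact ⟨(smul_eq_zero.mp h1).resolve_right (conjVec_ne_zero _ hx),
      (smul_eq_zero.mp h2).resolve_right (conjVec_ne_zero _ hx)⟩) h
  simp only [bil_slice] at h1 h2 h3
  exact ⟨_, y, z, hx, hy, hz, h1, h2, h3⟩

/-- Adding a multiple of the identity makes a pair of trilinear forms generic, outside a finite set
of exceptional multiples. -/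
lemma finite_degenerate (t : Fin 2 → Fin 2 → Fin 2 → Fin 2 → ℂ) :
    {ε : ℂ | ¬ ∀ x y,
      slice (fun i j k => t 0 i j k + if (0, i) = (j, k) then ε else 0) x +
        slice (fun i j k => t 1 i j k + if (1, i) = (j, k) then ε else 0) y = 0 →
      x = 0 ∧ y = 0}.Finite := by
  let V : Matrix (Fin 2 × Fin 2) (Fin 2 × Fin 2) ℂ := Matrix.of fun e f => t e.1 e.2 f.1 f.2
  refine ((-V).charpoly.roots.toFinset.finite_toSet).subset fun ε hε => ?_
  simp only [Finset.mem_coe, Multiset.mem_toFinset,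
    Polynomial.mem_roots (-V).charpoly_monic.ne_zero, Polynomial.IsRoot.def, Matrix.eval_charpoly]
  by_contra hdet
  apply hε
  intro x y hxy
  have h0 := Matrix.eq_zero_of_vecMul_eq_zero hdet (v := fun e => ![x, y] e.1 e.2) (by
    ext ⟨j, k⟩
    have := congrFun (congrFun hxy j) k
    simp [slice, Fin.sum_univ_two] at this
    simp [Matrix.vecMul, dotProduct, Fintype.sum_prod_type, Fin.sum_univ_two, V,
      Matrix.diagonal_apply]
    linear_combination this)
  constructor
  · ext i; exact congrFun h0 (0, i)
  · ext i; exact congrFun h0 (1, i)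

lemma exists_common_zero (a₁ a₂ a₃ b : Bool) (t₁ t₂ t₃ : Fin 2 → Fin 2 → Fin 2 → ℂ) :
    ∃ x y z : Fin 2 → ℂ, x ≠ 0 ∧ y ≠ 0 ∧ z ≠ 0 ∧ tri t₁ (conjVec a₁ x) y z = 0 ∧
      tri t₂ (conjVec a₂ x) y z = 0 ∧ tri t₃ (conjVec a₃ x) (conjVec b y) z = 0 := by
  let X := Metric.sphere (0 : Fin 2 → ℂ) 1
  let u : Fin 2 → ℂ → Fin 2 → Fin 2 → Fin 2 → ℂ := fun e ε i j k =>
    ![t₁, t₂] e i j k + if (e, i) = (j, k) then ε else 0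
  let C : Set (ℂ × X × X × X) := {p |
    tri (u 0 p.1) (conjVec a₁ p.2.1) p.2.2.1 p.2.2.2 = 0 ∧
    tri (u 1 p.1) (conjVec a₂ p.2.1) p.2.2.1 p.2.2.2 = 0 ∧
    tri t₃ (conjVec a₃ p.2.1) (conjVec b p.2.2.1) p.2.2.2 = 0}
  have hu : ∀ e, Continuous (u e) := by
    intro e
    refine continuous_pi fun i => continuous_pi fun j => continuous_pi fun k => ?_
    by_cases h : (e, i) = (j, k) <;> simp only [u, h, if_true, if_false] <;> fun_prop
  have hC : IsClosed C := by
    have h1 : Continuous fun p : ℂ × X × X × X =>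
        tri (u 0 p.1) (conjVec a₁ p.2.1) p.2.2.1 p.2.2.2 := by
      apply Continuous.tri <;> fun_prop
    have h2 : Continuous fun p : ℂ × X × X × X =>
        tri (u 1 p.1) (conjVec a₂ p.2.1) p.2.2.1 p.2.2.2 := by
      apply Continuous.tri <;> fun_prop
    have h3 : Continuous fun p : ℂ × X × X × X =>
        tri t₃ (conjVec a₃ p.2.1) (conjVec b p.2.2.1) p.2.2.2 := by
      apply Continuous.tri <;> fun_prop
    exact (isClosed_eq h1 continuous_const).inter
      ((isClosed_eq h2 continuous_const).inter (isClosed_eq h3 continuous_const))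
  have hK : IsClosed (Prod.fst '' C) := isClosedMap_fst_of_compactSpace _ hC
  have hsub : {ε : ℂ | ¬ ∀ x y, slice (u 0 ε) x + slice (u 1 ε) y = 0 → x = 0 ∧ y = 0}ᶜ ⊆
      Prod.fst '' C := by
    intro ε hε
    simp only [Set.mem_compl_iff, Set.mem_ofPred_eq, not_not] at hε
    obtain ⟨x, y, z, hx, hy, hz, h1, h2, h3⟩ :=
      exists_common_zero_of_generic a₁ a₂ a₃ b (u 0 ε) (u 1 ε) t₃ hε
    have hn : ∀ {v : Fin 2 → ℂ}, v ≠ 0 → ((‖v‖⁻¹ : ℝ) : ℂ) • v ∈ X := by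
      intro v hv
      simp [X, norm_smul, hv]
    refine ⟨(ε, ⟨_, hn hx⟩, ⟨_, hn hy⟩, ⟨_, hn hz⟩), ⟨?_, ?_, ?_⟩, rfl⟩ <;>
      simp [conjVec_smul, tri_smul, h1, h2, h3]
  have hdense := (finite_degenerate ![t₁, t₂]).countable.dense_compl ℝ
  have h0 : (0 : ℂ) ∈ Prod.fst '' C :=
    closure_minimal hsub hK (hdense 0)
  obtain ⟨⟨ε, x, y, z⟩, ⟨h1, h2, h3⟩, rfl : ε = 0⟩ := h0
  have hu0 : ∀ e, u e 0 = ![t₁, t₂] e := by intro e; ext; simp [u]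
  have hX : ∀ v : X, (v : Fin 2 → ℂ) ≠ 0 := fun v => ne_zero_of_mem_unit_sphere v
  simp only [hu0, Matrix.cons_val_zero, Matrix.cons_val_one] at h1 h2
  exact ⟨x, y, z, hX x, hX y, hX z, h1, h2, h3⟩

lemma exists_common_zero_of_xor_eq (s₁ s₂ s₃ : Fin 3 → Bool)
    (t₁ t₂ t₃ : Fin 2 → Fin 2 → Fin 2 → ℂ) (h : (s₁ 1 ^^ s₁ 2) = (s₂ 1 ^^ s₂ 2)) :
    ∃ x y z : Fin 2 → ℂ, x ≠ 0 ∧ y ≠ 0 ∧ z ≠ 0 ∧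
      tri t₁ (conjVec (s₁ 0) x) (conjVec (s₁ 1) y) (conjVec (s₁ 2) z) = 0 ∧
      tri t₂ (conjVec (s₂ 0) x) (conjVec (s₂ 1) y) (conjVec (s₂ 2) z) = 0 ∧
      tri t₃ (conjVec (s₃ 0) x) (conjVec (s₃ 1) y) (conjVec (s₃ 2) z) = 0 := by
  let e := s₁ 1 ^^ s₁ 2
  have key : ∀ (s : Fin 3 → Bool) (t : Fin 2 → Fin 2 → Fin 2 → ℂ) (x y z : Fin 2 → ℂ),
      tri (fun i j k => conjIf (s 2) (t i j k)) (conjVec (s 0 ^^ s 2) x)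
        (conjVec (s 1 ^^ s 2 ^^ e) y) z = 0 →
      tri t (conjVec (s 0) x) (conjVec (s 1) (conjVec e y)) (conjVec (s 2) z) = 0 := by
    intro s t x y z h
    apply (map_eq_zero (conjIf (s 2))).mp
    rw [conjIf_tri, ← h]
    simp only [conjVec_conjVec]
    congr 2
    · rw [Bool.xor_comm]
    · cases s 1 <;> cases s 2 <;> cases e <;> rfl
    · rw [Bool.xor_self]; rfl
  have hid : ∀ y, conjVec false y = y := fun y => rfl
  obtain ⟨x, y, z, hx, hy, hz, h1, h2, h3⟩ := exists_common_zero (s₁ 0 ^^ s₁ 2) (s₂ 0 ^^ s₂ 2)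
    (s₃ 0 ^^ s₃ 2) (s₃ 1 ^^ s₃ 2 ^^ e) (fun i j k => conjIf (s₁ 2) (t₁ i j k))
    (fun i j k => conjIf (s₂ 2) (t₂ i j k)) (fun i j k => conjIf (s₃ 2) (t₃ i j k))
  refine ⟨x, conjVec e y, z, hx, conjVec_ne_zero e hy, hz, key _ _ _ _ _ ?_, key _ _ _ _ _ ?_,
    key _ _ _ _ _ h3⟩
  · have : (s₁ 1 ^^ s₁ 2 ^^ e) = false := by simp only [e]; cases s₁ 1 <;> cases s₁ 2 <;> rfl
    rw [this]; exact h1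
  · have : (s₂ 1 ^^ s₂ 2 ^^ e) = false := by
      simp only [e, h]; cases s₂ 1 <;> cases s₂ 2 <;> rfl
    rw [this]; exact h2

/-- Three trilinear equations in three two-dimensional variables, each involving an arbitrary
pattern of complex conjugations of the variables, have a common solution with all variables
nonzero. -/
theorem exists_common_zero_of_conj_patterns (s : Fin 3 → Fin 3 → Bool)
    (t : Fin 3 → Fin 2 → Fin 2 → Fin 2 → ℂ) :
    ∃ x y z : Fin 2 → ℂ, x ≠ 0 ∧ y ≠ 0 ∧ z ≠ 0 ∧
      ∀ k, tri (t k) (conjVec (s k 0) x) (conjVec (s k 1) y) (conjVec (s k 2) z) = 0 := by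
  simp only [Fin.forall_fin_succ (n := 2), Fin.forall_fin_two]
  have hpigeon : ∀ p q r : Bool, p = q ∨ p = r ∨ q = r := by decide
  rcases hpigeon (s 0 1 ^^ s 0 2) (s 1 1 ^^ s 1 2) (s 2 1 ^^ s 2 2) with h | h | h
  · exact exists_common_zero_of_xor_eq _ _ _ _ _ _ h
  · obtain ⟨x, y, z, hx, hy, hz, h1, h2, h3⟩ :=
      exists_common_zero_of_xor_eq (s 0) (s 2) (s 1) (t 0) (t 2) (t 1) h
    exact ⟨x, y, z, hx, hy, hz, h1, h3, h2⟩
  · obtain ⟨x, y, z, hx, hy, hz, h1, h2, h3⟩ :=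
      exists_common_zero_of_xor_eq (s 1) (s 2) (s 0) (t 1) (t 2) (t 0) h
    exact ⟨x, y, z, hx, hy, hz, h3, h1, h2⟩

lemma sum_mul_partialConj (T : (Fin 3 → Fin 2) → ℂ) (S : Finset (Fin 3)) (ψ : Fin 3 → Fin 2 → ℂ) :
    ∑ i, T i * partialConj S ψ i =
      tri (fun i j k => T ![i, j, k]) (conjVec (decide (0 ∈ S)) (ψ 0))
        (conjVec (decide (1 ∈ S)) (ψ 1)) (conjVec (decide (2 ∈ S)) (ψ 2)) := by
  have h : ∀ (j : Fin 3), (if j ∈ S then fun i => starRingEnd ℂ (ψ j i) else ψ j) =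
      conjVec (decide (j ∈ S)) (ψ j) := by
    intro j
    by_cases hj : j ∈ S <;> simp only [hj, if_true, if_false, decide_true, decide_false] <;> rfl
  simp only [partialConj, prodVec, h, Fin.prod_univ_three, tri]
  rw [← (Fin.consEquiv fun _ => Fin 2).sum_comp, Fintype.sum_prod_type]
  refine Finset.sum_congr rfl fun i _ => ?_
  rw [← (Fin.consEquiv fun _ => Fin 2).sum_comp, Fintype.sum_prod_type]
  refine Finset.sum_congr rfl fun j _ => ?_
  rw [← (Equiv.funUnique (Fin 1) (Fin 2)).symm.sum_comp]
  refine Finset.sum_congr rfl fun k _ => ?_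
  have : (Fin.consEquiv fun _ => Fin 2) (i, (Fin.consEquiv fun _ => Fin 2)
      (j, (Equiv.funUnique (Fin 1) (Fin 2)).symm k)) = ![i, j, k] := by
    ext m; fin_cases m <;> rfl
  rw [this]
  rfl

/-- The range of a Hermitian matrix contains every vector orthogonal to its kernel. -/
lemma Matrix.IsHermitian.mem_range_mulVecLin {n : Type*} [Fintype n] [DecidableEq n]
    {A : Matrix n n ℂ} (hA : A.IsHermitian) {w : n → ℂ}
    (h : ∀ v, A.mulVec v = 0 → star v ⬝ᵥ w = 0) : w ∈ LinearMap.range A.mulVecLin := by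
  by_contra hw
  obtain ⟨f, hf, hle⟩ := Submodule.exists_le_ker_of_notMem hw
  set u : n → ℂ := fun i => f (Pi.single i 1)
  have hfu : ∀ v, f v = u ⬝ᵥ v := by
    intro v
    have : v = ∑ i, v i • (Pi.single i 1 : n → ℂ) := by
      ext; simp [Finset.sum_apply, Pi.single_apply]
    conv_lhs => rw [this]
    simp [u, dotProduct, mul_comm]
  have huA : Matrix.vecMul u A = 0 := by
    ext i
    have h0 : f (A.mulVecLin (Pi.single i 1)) = 0 := hle ⟨_, rfl⟩
    rw [Matrix.mulVecLin_apply, Matrix.mulVec_single_one, hfu] at h0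
    exact h0
  apply hf
  rw [hfu, ← star_star u]
  apply h
  rw [← hA.eq, ← Matrix.star_vecMul, huA, star_zero]

/-- Product vectors in the ranges of Hermitian matrices with at most three kernel directions in
total, with prescribed partial conjugations. -/
lemma exists_product_vector_in_ranges {κ : Type*} [Fintype κ]
    (A : κ → Matrix (Fin 3 → Fin 2) (Fin 3 → Fin 2) ℂ) (Q : κ → Finset (Fin 3))
    (hA : ∀ j, (A j).IsHermitian) (h : Fintype.card κ * 8 ≤ (∑ j, (A j).rank) + 3) :
    ∃ ψ : Fin 3 → Fin 2 → ℂ, (∀ j, ψ j ≠ 0) ∧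
      ∀ j, partialConj (Q j) ψ ∈ LinearMap.range (A j).mulVecLin := by
  classical
  let K := fun j => LinearMap.ker (A j).mulVecLin
  let ι := Σ j, Fin (Module.finrank ℂ (K j))
  have hcard : Fintype.card ι ≤ Fintype.card (Fin 3) := by
    have hrn : ∀ j, (A j).rank + Module.finrank ℂ (K j) = 8 := by
      intro j
      have := LinearMap.finrank_range_add_finrank_ker (A j).mulVecLin
      simpa [Matrix.rank] using this
    have hsum : ∑ j, ((A j).rank + Module.finrank ℂ (K j)) = Fintype.card κ * 8 := by
      simp [hrn]
    rw [Finset.sum_add_distrib] at hsum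
    simp only [ι, Fintype.card_sigma, Fintype.card_fin]
    omega
  obtain ⟨e⟩ := Function.Embedding.nonempty_of_card_le hcard
  let B := fun j => Module.finBasis ℂ (K j)
  let S : Fin 3 → Finset (Fin 3) := Function.extend e (fun i : ι => Q i.1) fun _ => ∅
  let T : Fin 3 → (Fin 3 → Fin 2) → ℂ :=
    Function.extend e (fun i : ι => star (B i.1 i.2 : (Fin 3 → Fin 2) → ℂ)) fun _ => 0
  obtain ⟨x, y, z, hx, hy, hz, hxyz⟩ := exists_common_zero_of_conj_patterns
    (fun k m => decide (m ∈ S k)) (fun k i j l => T k ![i, j, l])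
  refine ⟨![x, y, z], by simp [Fin.forall_fin_succ, hx, hy, hz], fun j => ?_⟩
  apply (hA j).mem_range_mulVecLin
  intro v hv
  let φ : K j →ₗ⋆[ℂ] ℂ :=
    { toFun := fun v => star (v : (Fin 3 → Fin 2) → ℂ) ⬝ᵥ partialConj (Q j) ![x, y, z]
      map_add' := by simp [add_dotProduct]
      map_smul' := by simp [smul_dotProduct] }
  have hφ : φ = 0 := by
    refine (B j).ext fun i => ?_
    have := hxyz (e ⟨j, i⟩)
    have hS : S (e ⟨j, i⟩) = Q j := e.injective.extend_apply _ _ _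
    have hT : T (e ⟨j, i⟩) = star (B j i : (Fin 3 → Fin 2) → ℂ) := e.injective.extend_apply _ _ _
    rw [hS, hT] at this
    exact (sum_mul_partialConj _ _ ![x, y, z]).trans this
  exact congrArg (fun f => f ⟨v, hv⟩) hφ

lemma partialTranspose_empty (ρ : Matrix (Fin 3 → Fin 2) (Fin 3 → Fin 2) ℂ) :
    partialTranspose ρ ∅ = ρ := by
  ext; simp [partialTranspose]

lemma partialTranspose_compl (ρ : Matrix (Fin 3 → Fin 2) (Fin 3 → Fin 2) ℂ)
    (S : Finset (Fin 3)) : partialTranspose ρ Sᶜ = (partialTranspose ρ S).transpose := by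
  ext x y
  simp [partialTranspose, ite_not]

lemma partialConj_compl (S : Finset (Fin 3)) (ψ : Fin 3 → Fin 2 → ℂ) :
    partialConj Sᶜ ψ = star (partialConj S ψ) := by
  ext x
  simp only [partialConj, prodVec, Pi.star_apply, star_prod]
  refine Finset.prod_congr rfl fun j _ => ?_
  by_cases hj : j ∈ S <;> simp [hj]

lemma partialConj_compl_mem_range {ρ : Matrix (Fin 3 → Fin 2) (Fin 3 → Fin 2) ℂ}
    {S : Finset (Fin 3)} (hS : (partialTranspose ρ S).IsHermitian) {ψ : Fin 3 → Fin 2 → ℂ}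
    (h : partialConj S ψ ∈ LinearMap.range (partialTranspose ρ S).mulVecLin) :
    partialConj Sᶜ ψ ∈ LinearMap.range (partialTranspose ρ Sᶜ).mulVecLin := by
  obtain ⟨v, hv⟩ := h
  refine ⟨star v, ?_⟩
  rw [Matrix.mulVecLin_apply] at hv
  rw [partialConj_compl, partialTranspose_compl, ← hv, Matrix.mulVecLin_apply, Matrix.star_mulVec,
    hS.eq, Matrix.mulVec_transpose]

/-- If `ρ` is a three-qubit PPT state (every partial transpose is positive semidefinite)
which is an edge state (no nonzero product vector `ψ` has `ψ^{Γ(S)}` in the range of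
`ρ^{T(S)}` for every `S ⊆ {1,2,3}`), then the sum of the ranks of `ρ, ρ^{T(1)}, ρ^{T(2)},
ρ^{T(3)}` is at most `28`. -/
theorem three_qubit_edge_rank_bound (ρ : Matrix (Fin 3 → Fin 2) (Fin 3 → Fin 2) ℂ)
    (hpsd : ρ.PosSemidef)
    (hppt : ∀ S : Finset (Fin 3), (partialTranspose ρ S).PosSemidef)
    (hedge : ¬ ∃ ψ : Fin 3 → Fin 2 → ℂ, (∀ j, ψ j ≠ 0) ∧
      ∀ S : Finset (Fin 3),
        partialConj S ψ ∈ LinearMap.range (partialTranspose ρ S).mulVecLin) :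
    ρ.rank + (partialTranspose ρ {0}).rank + (partialTranspose ρ {1}).rank +
      (partialTranspose ρ {2}).rank ≤ 28 := by
  by_contra hgt
  apply hedge
  let Q : Fin 4 → Finset (Fin 3) := ![∅, {0}, {1}, {2}]
  obtain ⟨ψ, hψ, hrange⟩ := exists_product_vector_in_ranges (fun j => partialTranspose ρ (Q j)) Q
    (fun j => (hppt (Q j)).isHermitian) (by
      simp [Fin.sum_univ_four, Q, partialTranspose_empty]
      omega)
  refine ⟨ψ, hψ, fun S => ?_⟩
  have hcases : ∀ S : Finset (Fin 3), ∃ j, S = Q j ∨ S = (Q j)ᶜ := by decide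
  obtain ⟨j, rfl | rfl⟩ := hcases S
  · exact hrange j
  · exact partialConj_compl_mem_range (hppt _).isHermitian (hrange j)
end
end
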